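/- Let t1 < t2 be real numbers with Δt = t2 − t1, and let f : ℝ → ℝ be 6-times continuously differentiable on [t1, t2]. Then there exists τ ∈ [t1, t2] such that ∫_{t1}^{t2} f(t) dt = (Δt/2)(f(t1) + f(t2)) + (Δt²/10)(f'(t1) − f'(t2)) + (Δt³/120)(f''(t1) + f''(t2)) − (Δt⁷/100800) f^{(6)}(τ). (Lotkin's sixth-order integration rule with remainder.) -/

import Mathlib

/-- On the interior of a closed interval, the iterated derivatives within the interval of a `C^n`
function are differentiable, with the expected derivative. -/
theorem ContDiffOn.hasDerivAt_iteratedDerivWithin_Icc {f : ℝ → ℝ} {a b x : ℝ} {n k : ℕ}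
    (hf : ContDiffOn ℝ n f (Set.Icc a b)) (hk : k < n) (hx : x ∈ Set.Ioo a b) :
    HasDerivAt (iteratedDerivWithin k f (Set.Icc a b))
      (iteratedDerivWithin (k + 1) f (Set.Icc a b) x) x := by
  have hd := hf.differentiableOn_iteratedDerivWithin (m := k) (by exact_mod_cast hk)
    (uniqueDiffOn_Icc (hx.1.trans hx.2))
  rw [iteratedDerivWithin_succ]
  exact (hd x (Set.Ioo_subset_Icc_self hx)).hasDerivWithinAt.hasDerivAt (Icc_mem_nhds hx.1 hx.2)

/-- The derivative of an alternating sum of products of derivatives of the Lotkin kernel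
`u ^ 3 * (u - d) ^ 3` with derivatives of a function telescopes. -/
theorem hasDerivAt_lotkin_boundary {g₀ g₁ g₂ g₃ g₄ g₅ : ℝ → ℝ} {y a d x : ℝ}
    (h₀ : HasDerivAt g₀ (g₁ x) x) (h₁ : HasDerivAt g₁ (g₂ x) x)
    (h₂ : HasDerivAt g₂ (g₃ x) x) (h₃ : HasDerivAt g₃ (g₄ x) x)
    (h₄ : HasDerivAt g₄ (g₅ x) x) (h₅ : HasDerivAt g₅ y x) :
    HasDerivAt (fun t =>
      ((t - a) ^ 6 - 3 * d * (t - a) ^ 5 + 3 * d ^ 2 * (t - a) ^ 4 - d ^ 3 * (t - a) ^ 3) * g₅ t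
      - (6 * (t - a) ^ 5 - 15 * d * (t - a) ^ 4 + 12 * d ^ 2 * (t - a) ^ 3
          - 3 * d ^ 3 * (t - a) ^ 2) * g₄ t
      + (30 * (t - a) ^ 4 - 60 * d * (t - a) ^ 3 + 36 * d ^ 2 * (t - a) ^ 2
          - 6 * d ^ 3 * (t - a)) * g₃ t
      - (120 * (t - a) ^ 3 - 180 * d * (t - a) ^ 2 + 72 * d ^ 2 * (t - a) - 6 * d ^ 3) * g₂ t
      + (360 * (t - a) ^ 2 - 360 * d * (t - a) + 72 * d ^ 2) * g₁ t
      - (720 * (t - a) - 360 * d) * g₀ t)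
      ((x - a) ^ 3 * (x - a - d) ^ 3 * y - 720 * g₀ x) x := by
  have hu : HasDerivAt (fun t => t - a) 1 x := (hasDerivAt_id x).sub_const a
  have hk₀ := ((((hu.pow 6).sub ((hu.pow 5).const_mul (3 * d))).add
    ((hu.pow 4).const_mul (3 * d ^ 2))).sub ((hu.pow 3).const_mul (d ^ 3))).mul h₅
  have hk₁ := (((((hu.pow 5).const_mul 6).sub ((hu.pow 4).const_mul (15 * d))).add
    ((hu.pow 3).const_mul (12 * d ^ 2))).sub ((hu.pow 2).const_mul (3 * d ^ 3))).mul h₄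
  have hk₂ := (((((hu.pow 4).const_mul 30).sub ((hu.pow 3).const_mul (60 * d))).add
    ((hu.pow 2).const_mul (36 * d ^ 2))).sub (hu.const_mul (6 * d ^ 3))).mul h₃
  have hk₃ := (((((hu.pow 3).const_mul 120).sub ((hu.pow 2).const_mul (180 * d))).add
    (hu.const_mul (72 * d ^ 2))).sub_const (6 * d ^ 3)).mul h₂
  have hk₄ := ((((hu.pow 2).const_mul 360).sub (hu.const_mul (360 * d))).add_const
    (72 * d ^ 2)).mul h₁
  have hk₅ := ((hu.const_mul 720).sub_const (360 * d)).mul h₀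
  refine (((((hk₀.sub hk₁).add hk₂).sub hk₃).add hk₄).sub hk₅).congr_deriv ?_
  simp only [Pi.add_apply, Pi.sub_apply, Pi.pow_apply]
  push_cast
  ring

/-- The antiderivative of the Lotkin kernel `u ^ 3 * (u - d) ^ 3`. -/
theorem hasDerivAt_lotkin_kernel_primitive (a d x : ℝ) :
    HasDerivAt (fun t => 1 / 7 * (t - a) ^ 7 - d / 2 * (t - a) ^ 6 + 3 * d ^ 2 / 5 * (t - a) ^ 5
      - d ^ 3 / 4 * (t - a) ^ 4) ((x - a) ^ 3 * (x - a - d) ^ 3) x := by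
  have hu : HasDerivAt (fun t => t - a) 1 x := (hasDerivAt_id x).sub_const a
  refine (((((hu.pow 7).const_mul (1 / 7)).sub ((hu.pow 6).const_mul (d / 2))).add
    ((hu.pow 5).const_mul (3 * d ^ 2 / 5))).sub ((hu.pow 4).const_mul (d ^ 3 / 4))).congr_deriv ?_
  push_cast
  ring


/-- Lotkin's sixth-order integration rule with remainder: if `f` is 6-times
continuously differentiable on `[t1, t2]` with `t1 < t2`, then there is
`τ ∈ [t1, t2]` with
`∫_{t1}^{t2} f = (Δt/2)(f(t1)+f(t2)) + (Δt²/10)(f'(t1)-f'(t2))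
  + (Δt³/120)(f''(t1)+f''(t2)) - (Δt⁷/100800) f⁽⁶⁾(τ)`. -/
theorem lotkin_rule (t1 t2 : ℝ) (h12 : t1 < t2)
    (f : ℝ → ℝ) (hf : ContDiffOn ℝ 6 f (Set.Icc t1 t2)) :
    ∃ τ ∈ Set.Icc t1 t2,
      ∫ t in t1..t2, f t =
        (t2 - t1) / 2 * (f t1 + f t2)
        + (t2 - t1) ^ 2 / 10 *
            (iteratedDerivWithin 1 f (Set.Icc t1 t2) t1 -
              iteratedDerivWithin 1 f (Set.Icc t1 t2) t2)
        + (t2 - t1) ^ 3 / 120 *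
            (iteratedDerivWithin 2 f (Set.Icc t1 t2) t1 +
              iteratedDerivWithin 2 f (Set.Icc t1 t2) t2)
        - (t2 - t1) ^ 7 / 100800 * iteratedDerivWithin 6 f (Set.Icc t1 t2) τ := by
  have hcont : ∀ k ≤ 6, ContinuousOn (iteratedDerivWithin k f (Set.Icc t1 t2)) (Set.Icc t1 t2) :=
    fun k hk => hf.continuousOn_iteratedDerivWithin (by exact_mod_cast hk) (uniqueDiffOn_Icc h12)
  have hderiv : ∀ x ∈ Set.Ioo t1 t2, ∀ k < 6,
      HasDerivAt (iteratedDerivWithin k f (Set.Icc t1 t2))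
        (iteratedDerivWithin (k + 1) f (Set.Icc t1 t2) x) x :=
    fun x hx k hk => ContDiffOn.hasDerivAt_iteratedDerivWithin_Icc (n := 6) hf hk hx
  have hzero : iteratedDerivWithin 0 f (Set.Icc t1 t2) = f := iteratedDerivWithin_zero
  have c₀ := hcont 0 (by norm_num)
  have c₁ := hcont 1 (by norm_num)
  have c₂ := hcont 2 (by norm_num)
  have c₃ := hcont 3 (by norm_num)
  have c₄ := hcont 4 (by norm_num)
  have c₅ := hcont 5 (by norm_num)
  have hfc : ContinuousOn f (Set.Icc t1 t2) := hf.continuousOn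
  have hint : IntervalIntegrable f MeasureTheory.volume t1 t2 :=
    hfc.intervalIntegrable_of_Icc h12.le
  have hprim : ContinuousOn (fun x => ∫ t in t1..x, f t) (Set.Icc t1 t2) := by
    have := intervalIntegral.continuousOn_primitive_interval' hint Set.left_mem_uIcc
    rwa [Set.uIcc_of_le h12.le] at this
  have hprim' : ∀ x ∈ Set.Ioo t1 t2, HasDerivAt (fun x => ∫ t in t1..x, f t) (f x) x := by
    intro x hx
    have hIcc : Set.Icc t1 t2 ∈ nhds x := Icc_mem_nhds hx.1 hx.2
    refine intervalIntegral.integral_hasDerivAt_right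
      (hint.mono_set ?_) ?_ (hfc.continuousAt hIcc)
    · rw [Set.uIcc_of_le h12.le, Set.uIcc_of_le hx.1.le]
      exact Set.Icc_subset_Icc_right hx.2.le
    · exact (hfc.mono Set.Ioo_subset_Icc_self).stronglyMeasurableAtFilter isOpen_Ioo x hx
  obtain ⟨τ, hτ, h⟩ := exists_ratio_hasDerivAt_eq_ratio_slope _ _ h12
    (by fun_prop) (fun x hx => ((hprim' x hx).const_mul 720).add (hasDerivAt_lotkin_boundary
      (a := t1) (d := t2 - t1)
      (hderiv x hx 0 (by norm_num)) (hderiv x hx 1 (by norm_num))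
      (hderiv x hx 2 (by norm_num)) (hderiv x hx 3 (by norm_num))
      (hderiv x hx 4 (by norm_num)) (hderiv x hx 5 (by norm_num))))
    _ _ (by fun_prop) (fun x _ => hasDerivAt_lotkin_kernel_primitive t1 (t2 - t1) x)
  refine ⟨τ, Set.Ioo_subset_Icc_self hτ, ?_⟩
  have hK : (τ - t1) ^ 3 * (τ - t1 - (t2 - t1)) ^ 3 ≠ 0 :=
    mul_ne_zero (pow_ne_zero _ (sub_ne_zero.2 hτ.1.ne'))
      (pow_ne_zero _ (by rw [sub_sub_sub_cancel_right]; exact sub_ne_zero.2 hτ.2.ne))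
  simp only [hzero, Pi.add_apply, intervalIntegral.integral_same] at h
  refine mul_left_cancel₀ hK ?_
  linear_combination (-1 / 720) * h
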